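/- For every integer k ≥ 2, the function Θ_C^{(k)} is holomorphic on 𝔹ⁿ and satisfies Θ_C^{(k)}(Az)·J(A,z)^k = Θ_C^{(k)}(z) for all A ∈ Γ and z ∈ 𝔹ⁿ; that is, Θ_C^{(k)} ∈ H̃⁰_Γ(k). -/

import Mathlib

open scoped BigOperators
open Complex MeasureTheory Filter Topology Matrix

namespace BallPaper

noncomputable section

variable {n : ℕ}

/-- The unit ball in ℂⁿ. -/
def ball (n : ℕ) : Set (Fin n → ℂ) := {z | ∑ i, ‖z i‖ ^ 2 < 1}

/-- ⟨z,w⟩ = z₁ conj w₁ + ... + zₙ conj wₙ − 1. -/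
def pair (z w : Fin n → ℂ) : ℂ := ∑ i, z i * star (w i) - 1

/-- The Hermitian form of signature (n,1) on ℂ^{n+1}:
⟨⟨u,v⟩⟩ = u₁ conj v₁ + ... + uₙ conj vₙ − u_{n+1} conj v_{n+1}. -/
def herm (u v : Fin (n + 1) → ℂ) : ℂ :=
  ∑ i : Fin n, u i.castSucc * star (v i.castSucc) - u (Fin.last n) * star (v (Fin.last n))

/-- SU(n,1): determinant-one matrices preserving the (n,1) Hermitian form. -/
def SU (n : ℕ) : Set (Matrix (Fin (n + 1)) (Fin (n + 1)) ℂ) :=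
  {A | A.det = 1 ∧ ∀ u v, herm (A.mulVec u) (A.mulVec v) = herm u v}

/-- The denominator a_{n+1,1} z₁ + ... + a_{n+1,n} zₙ + a_{n+1,n+1} of the
fractional-linear action. -/
def denom (A : Matrix (Fin (n + 1)) (Fin (n + 1)) ℂ) (z : Fin n → ℂ) : ℂ :=
  ∑ j : Fin n, A (Fin.last n) j.castSucc * z j + A (Fin.last n) (Fin.last n)

/-- The fractional-linear action of a matrix on ℂⁿ (defined on the ball). -/
def act (A : Matrix (Fin (n + 1)) (Fin (n + 1)) ℂ) (z : Fin n → ℂ) : Fin n → ℂ :=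
  fun j => (∑ l : Fin n, A j.castSucc l.castSucc * z l + A j.castSucc (Fin.last n)) / denom A z

/-- The complex Jacobian J(A,z) = (denominator)^{-(n+1)}. -/
def jac (A : Matrix (Fin (n + 1)) (Fin (n + 1)) ℂ) (z : Fin n → ℂ) : ℂ :=
  (denom A z)⁻¹ ^ (n + 1)

/-- The Bergman kernel K(z,w) = (n!/πⁿ) (−⟨z,w⟩)^{−(n+1)}. -/
def Kc (z w : Fin n → ℂ) : ℂ :=
  (((Nat.factorial n : ℝ) / Real.pi ^ n : ℝ) : ℂ) * (-(pair z w))⁻¹ ^ (n + 1)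

/-- K(z,z) as a real-valued function: K(z,z) = (n!/πⁿ) (1−|z|²)^{−(n+1)}. -/
def Kr (z : Fin n → ℂ) : ℝ :=
  (Nat.factorial n : ℝ) / Real.pi ^ n * ((1 - ∑ i, ‖z i‖ ^ 2)⁻¹) ^ (n + 1)

/-- c(𝔹ⁿ,k) = C((n+1)(k−1)+n, n). -/
def cB (n k : ℕ) : ℕ := Nat.choose ((n + 1) * (k - 1) + n) n

/-- The last index of Fin n. -/
def lastI (n : ℕ) (hn : 0 < n) : Fin n := ⟨n - 1, by omega⟩

/-- The geodesic C̃₀ = {z ∈ 𝔹ⁿ : z₁ = ... = z_{n−1} = 0, zₙ ∈ (−1,1) real}. -/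
def geo0 (n : ℕ) (hn : 0 < n) : Set (Fin n → ℂ) :=
  {z | (∀ i : Fin n, (i : ℕ) < n - 1 → z i = 0) ∧ (z (lastI n hn)).im = 0 ∧
    -1 < (z (lastI n hn)).re ∧ (z (lastI n hn)).re < 1}

/-- The point (0,...,0,x) of C̃₀. -/
def curve (n : ℕ) (hn : 0 < n) (x : ℝ) : Fin n → ℂ :=
  fun i => if i = lastI n hn then (x : ℂ) else 0

/-- The vector (X,1) ∈ ℂ^{n+1}. -/
def snoc1 (X : Fin n → ℂ) : Fin (n + 1) → ℂ := Fin.snoc X 1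

/-- The matrix A_γ, with columns v₁,...,v_{n−1},
⟨X,Y⟩⁻¹(X,1) + (1/2)(Y,1), ⟨X,Y⟩⁻¹(X,1) − (1/2)(Y,1). -/
def Amat (n : ℕ) (v : Fin (n - 1) → Fin (n + 1) → ℂ) (X Y : Fin n → ℂ) :
    Matrix (Fin (n + 1)) (Fin (n + 1)) ℂ :=
  Matrix.of fun i j =>
    if h : (j : ℕ) < n - 1 then v ⟨j, h⟩ i
    else if (j : ℕ) = n - 1 then ((pair X Y)⁻¹ • snoc1 X + (2 : ℂ)⁻¹ • snoc1 Y) i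
    else ((pair X Y)⁻¹ • snoc1 X - (2 : ℂ)⁻¹ • snoc1 Y) i

/-- σ = diag(1,...,1,−1). -/
def sigmaM (n : ℕ) : Matrix (Fin (n + 1)) (Fin (n + 1)) ℂ :=
  Matrix.diagonal fun i => if i = Fin.last n then -1 else 1

/-- Inverse hyperbolic cosine. -/
def arcosh (x : ℝ) : ℝ := Real.log (x + Real.sqrt (x ^ 2 - 1))

/-- Inverse hyperbolic tangent. -/
def artanh (x : ℝ) : ℝ := Real.log ((1 + x) / (1 - x)) / 2

/-- The hyperbolic (Bergman) distance on the ball, determined by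
cosh²(ρ(z,w)/2) = ⟨z,w⟩⟨w,z⟩/(⟨z,z⟩⟨w,w⟩). -/
def rho (z w : Fin n → ℂ) : ℝ :=
  2 * arcosh (Real.sqrt ((pair z w * pair w z).re / (pair z z * pair w w).re))

/-- A discrete subgroup Γ of SU(n,1) acting freely on the ball with compact quotient. -/
structure DiscreteGroup (n : ℕ) where
  Γ : Set (Matrix (Fin (n + 1)) (Fin (n + 1)) ℂ)
  sub_SU : Γ ⊆ SU n
  one_mem : 1 ∈ Γ
  mul_mem : ∀ {A B}, A ∈ Γ → B ∈ Γ → A * B ∈ Γ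
  inv_mem : ∀ {A}, A ∈ Γ → A⁻¹ ∈ Γ
  discrete : DiscreteTopology ↥Γ
  free : ∀ A ∈ Γ, (∃ z ∈ ball n, act A z = z) → A = 1
  cocompact : ∃ F : Set (Fin n → ℂ), F ⊆ ball n ∧ IsCompact F ∧
    ∀ z ∈ ball n, ∃ A ∈ Γ, act A z ∈ F

/-- A hyperbolic element γ of Γ, with real eigenvalues, real fixed points X, Y on the
boundary, eigenvalue data λ, and the eigenvectors v₁,...,v_{n−1} for eigenvalues ±1,
orthonormal with respect to the form ⟨⟨.,.⟩⟩. -/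
structure HypElt (n : ℕ) (G : DiscreteGroup n) where
  γ : Matrix (Fin (n + 1)) (Fin (n + 1)) ℂ
  mem : γ ∈ G.Γ
  ne_one : γ ≠ 1
  eig_real : ∀ μ ∈ spectrum ℂ γ, μ.im = 0
  X : Fin n → ℂ
  Y : Fin n → ℂ
  X_bd : ∑ i, ‖X i‖ ^ 2 = 1
  Y_bd : ∑ i, ‖Y i‖ ^ 2 = 1
  X_real : ∀ i, (X i).im = 0
  Y_real : ∀ i, (Y i).im = 0
  lam : ℝ
  lam_sq : 1 < lam ^ 2
  eigX : γ.mulVec (snoc1 X) = (lam : ℂ) • snoc1 X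
  eigY : γ.mulVec (snoc1 Y) = ((lam : ℂ))⁻¹ • snoc1 Y
  primitive : ∀ A ∈ G.Γ, ∀ m : ℕ, 2 ≤ m → A ^ m ≠ γ
  v : Fin (n - 1) → Fin (n + 1) → ℂ
  alph : Fin (n - 1) → ℂ
  alph_pm : ∀ j, alph j = 1 ∨ alph j = -1
  v_eig : ∀ j, γ.mulVec (v j) = alph j • v j
  v_on : ∀ j l, herm (v j) (v l) = if j = l then 1 else 0

variable {G : DiscreteGroup n}

/-- The matrix A_γ associated to the hyperbolic element γ. -/
def HypElt.A (H : HypElt n G) : Matrix (Fin (n + 1)) (Fin (n + 1)) ℂ :=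
  Amat n H.v H.X H.Y

/-- γ₀ = A_γ⁻¹ γ A_γ. -/
def HypElt.g0 (H : HypElt n G) : Matrix (Fin (n + 1)) (Fin (n + 1)) ℂ :=
  (H.A)⁻¹ * H.γ * H.A

/-- T = (λ²−1)/(λ²+1), the last coordinate of γ₀(0). -/
def HypElt.T (H : HypElt n G) : ℝ := (H.lam ^ 2 - 1) / (H.lam ^ 2 + 1)

/-- The geodesic C̃ in 𝔹ⁿ with endpoints X, Y, as the image of C̃₀ under A_γ. -/
def HypElt.Ct (H : HypElt n G) (hn : 0 < n) : Set (Fin n → ℂ) :=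
  act H.A '' geo0 n hn

/-- The length l(C) of the closed geodesic C, the hyperbolic distance from 0 to γ₀(0). -/
def HypElt.lenC (H : HypElt n G) : ℝ :=
  rho (0 : Fin n → ℂ) (act H.g0 (0 : Fin n → ℂ))

/-- A (measure-theoretic) fundamental domain for the action of Γ on the ball. -/
def IsFundDom (G : DiscreteGroup n) (F : Set (Fin n → ℂ)) : Prop :=
  F ⊆ ball n ∧ MeasurableSet F ∧ (∀ z ∈ ball n, ∃ A ∈ G.Γ, act A z ∈ F) ∧
    ∀ A ∈ G.Γ, A ≠ 1 → volume {z ∈ F | act A z ∈ F} = 0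

/-- The automorphy condition f(Az) J(A,z)^k = f(z). -/
def Automorphic (G : DiscreteGroup n) (k : ℕ) (f : (Fin n → ℂ) → ℂ) : Prop :=
  ∀ A ∈ G.Γ, ∀ z ∈ ball n, f (act A z) * jac A z ^ k = f z

/-- Membership in H̃⁰_Γ(k): holomorphic on the ball and automorphic of weight k. -/
def Htilde (G : DiscreteGroup n) (k : ℕ) (f : (Fin n → ℂ) → ℂ) : Prop :=
  DifferentiableOn ℂ f (ball n) ∧ Automorphic G k f

/-- The inner product (f,g) = ∫_M f ḡ K(z,z)^{−k} dV = ∫_F f ḡ K(z,z)^{1−k} dV_e,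
computed over a fundamental domain F. -/
def iprod (F : Set (Fin n → ℂ)) (k : ℕ) (f g : (Fin n → ℂ) → ℂ) : ℂ :=
  ∫ z in F, f z * star (g z) * ((Kr z ^ ((1 : ℤ) - (k : ℤ)) : ℝ) : ℂ)

/-- The Poincaré series Θ_w^{(k)}(z) = c(𝔹ⁿ,k) Σ_{A∈Γ} K(Az,w)^k J(A,z)^k. -/
def ThetaPt (G : DiscreteGroup n) (k : ℕ) (w z : Fin n → ℂ) : ℂ :=
  (cB n k : ℂ) * ∑' A : ↥G.Γ, Kc (act (A : Matrix (Fin (n + 1)) (Fin (n + 1)) ℂ) z) w ^ k *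
    jac (A : Matrix (Fin (n + 1)) (Fin (n + 1)) ℂ) z ^ k

/-- The relative Poincaré series
Θ_C^{(k)}(z) = ∫_C Θ_w^{(k)}(z) K(w,w)^{−k/2} ((A_γ⁻¹)*φ)(w), written out over one
period of C̃, parametrized by w = A_γ(0,...,0,x), x ∈ [0,T]. -/
def ThetaC (hn : 0 < n) (H : HypElt n G) (k : ℕ) (z : Fin n → ℂ) : ℂ :=
  ∫ x in (0 : ℝ)..H.T, ThetaPt G k (act H.A (curve n hn x)) z *
    ((Kr (act H.A (curve n hn x)) ^ (-(k : ℝ) / 2) : ℝ) : ℂ) *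
    ((Kr (curve n hn x) ^ (((n : ℝ) + 1))⁻¹ : ℝ) : ℂ)

/-- The set of integer powers of a matrix. -/
def zpows (g : Matrix (Fin (n + 1)) (Fin (n + 1)) ℂ) :
    Set (Matrix (Fin (n + 1)) (Fin (n + 1)) ℂ) := {h | ∃ m : ℤ, h = g ^ m}

/-- The conjugate group A_γ⁻¹ Γ A_γ. -/
def conjGrp (G : DiscreteGroup n) (H : HypElt n G) :
    Set (Matrix (Fin (n + 1)) (Fin (n + 1)) ℂ) :=
  (fun g => (H.A)⁻¹ * g * H.A) '' G.Γ

end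

end BallPaper

namespace BallPaper

section

variable {n : ℕ}

lemma herm_self (u : Fin (n + 1) → ℂ) :
    herm u u = ((∑ i : Fin n, ‖u i.castSucc‖ ^ 2 - ‖u (Fin.last n)‖ ^ 2 : ℝ) : ℂ) := by
  simp only [herm, ← starRingEnd_apply, Complex.mul_conj']
  push_cast
  rfl

lemma herm_eq_dotProduct (u v : Fin (n + 1) → ℂ) :
    herm u v = star v ⬝ᵥ (sigmaM n *ᵥ u) := by
  simp [herm, sigmaM, dotProduct, Matrix.mulVec_diagonal, Fin.sum_univ_castSucc, mul_comm,
    Fin.castSucc_ne_last, sub_eq_add_neg]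

lemma conjTranspose_mul_sigmaM_mul {A : Matrix (Fin (n + 1)) (Fin (n + 1)) ℂ}
    (hA : ∀ u v, herm (A *ᵥ u) (A *ᵥ v) = herm u v) : Aᴴ * sigmaM n * A = sigmaM n := by
  have key : ∀ u v : Fin (n + 1) → ℂ,
      star v ⬝ᵥ ((Aᴴ * sigmaM n * A) *ᵥ u) = star v ⬝ᵥ (sigmaM n *ᵥ u) := by
    intro u v
    have h := hA u v
    rw [herm_eq_dotProduct, herm_eq_dotProduct, Matrix.star_mulVec, ← Matrix.dotProduct_mulVec,
      Matrix.mulVec_mulVec, Matrix.mulVec_mulVec] at h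
    exact h
  ext l j
  have h := key (Pi.single j 1) (Pi.single l 1)
  simpa [← Pi.single_star] using h

lemma sigmaM_mul_self : sigmaM n * sigmaM n = 1 := by
  rw [sigmaM, Matrix.diagonal_mul_diagonal, ← Matrix.diagonal_one]
  congr 1
  ext i
  split_ifs <;> simp

lemma mul_sigmaM_mul_conjTranspose {A : Matrix (Fin (n + 1)) (Fin (n + 1)) ℂ}
    (hA : ∀ u v, herm (A *ᵥ u) (A *ᵥ v) = herm u v) : A * sigmaM n * Aᴴ = sigmaM n := by
  have h1 : (sigmaM n * Aᴴ * sigmaM n) * A = 1 := by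
    rw [Matrix.mul_assoc, Matrix.mul_assoc, ← Matrix.mul_assoc Aᴴ,
      conjTranspose_mul_sigmaM_mul hA, sigmaM_mul_self]
  have h2 := mul_eq_one_comm.mp h1
  calc A * sigmaM n * Aᴴ = A * (sigmaM n * Aᴴ * sigmaM n) * sigmaM n := by
        simp only [Matrix.mul_assoc, sigmaM_mul_self, Matrix.mul_one]
    _ = sigmaM n := by rw [h2, Matrix.one_mul]

lemma herm_row_self {A : Matrix (Fin (n + 1)) (Fin (n + 1)) ℂ}
    (hA : ∀ u v, herm (A *ᵥ u) (A *ᵥ v) = herm u v) (i : Fin (n + 1)) :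
    herm (A i) (A i) = sigmaM n i i := by
  have h := congrFun (congrFun (mul_sigmaM_mul_conjTranspose hA) i) i
  rw [← h, herm_eq_dotProduct, Matrix.mul_apply]
  simp [sigmaM, dotProduct, Matrix.mulVec_diagonal, Matrix.mul_diagonal, mul_comm]

lemma sum_norm_sq_row_castSucc {A : Matrix (Fin (n + 1)) (Fin (n + 1)) ℂ}
    (hA : ∀ u v, herm (A *ᵥ u) (A *ᵥ v) = herm u v) (i : Fin n) :
    ∑ j : Fin n, ‖A i.castSucc j.castSucc‖ ^ 2 = 1 + ‖A i.castSucc (Fin.last n)‖ ^ 2 := by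
  have h := herm_row_self hA i.castSucc
  rw [herm_self] at h
  simp only [sigmaM, Matrix.diagonal_apply_eq, Fin.castSucc_ne_last, if_false] at h
  have h' := Complex.ofReal_injective (h.trans Complex.ofReal_one.symm)
  linarith

lemma sum_norm_sq_row_last {A : Matrix (Fin (n + 1)) (Fin (n + 1)) ℂ}
    (hA : ∀ u v, herm (A *ᵥ u) (A *ᵥ v) = herm u v) :
    ∑ j : Fin n, ‖A (Fin.last n) j.castSucc‖ ^ 2 = ‖A (Fin.last n) (Fin.last n)‖ ^ 2 - 1 := by
  have h := herm_row_self hA (Fin.last n)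
  rw [herm_self] at h
  simp only [sigmaM, Matrix.diagonal_apply_eq, if_true] at h
  have h' : (∑ j : Fin n, ‖A (Fin.last n) j.castSucc‖ ^ 2 - ‖A (Fin.last n) (Fin.last n)‖ ^ 2)
      = (-1 : ℝ) := Complex.ofReal_injective (by rw [h]; simp)
  linarith

lemma sum_norm_sq_col_last {A : Matrix (Fin (n + 1)) (Fin (n + 1)) ℂ}
    (hA : ∀ u v, herm (A *ᵥ u) (A *ᵥ v) = herm u v) :
    ∑ i : Fin n, ‖A i.castSucc (Fin.last n)‖ ^ 2 = ‖A (Fin.last n) (Fin.last n)‖ ^ 2 - 1 := by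
  have h := hA (Pi.single (Fin.last n) 1) (Pi.single (Fin.last n) 1)
  rw [herm_self, herm_self] at h
  have h' := Complex.ofReal_injective h
  simp [Fin.castSucc_ne_last] at h'
  linarith

lemma one_le_norm_last_last {A : Matrix (Fin (n + 1)) (Fin (n + 1)) ℂ}
    (hA : ∀ u v, herm (A *ᵥ u) (A *ᵥ v) = herm u v) :
    1 ≤ ‖A (Fin.last n) (Fin.last n)‖ := by
  have h := sum_norm_sq_row_last hA
  have h0 : 0 ≤ ∑ j : Fin n, ‖A (Fin.last n) j.castSucc‖ ^ 2 := by positivity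
  nlinarith [norm_nonneg (A (Fin.last n) (Fin.last n))]

/-- The corner entry of a matrix preserving the form dominates all the other entries. -/
lemma norm_entry_le {A : Matrix (Fin (n + 1)) (Fin (n + 1)) ℂ}
    (hA : ∀ u v, herm (A *ᵥ u) (A *ᵥ v) = herm u v) (i j : Fin (n + 1)) :
    ‖A i j‖ ≤ ‖A (Fin.last n) (Fin.last n)‖ := by
  refine (sq_le_sq₀ (norm_nonneg _) (norm_nonneg _)).mp ?_
  have hcol : ∀ i : Fin n, ‖A i.castSucc (Fin.last n)‖ ^ 2 ≤
      ‖A (Fin.last n) (Fin.last n)‖ ^ 2 - 1 := fun i =>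
    sum_norm_sq_col_last hA ▸ Finset.single_le_sum
      (f := fun i : Fin n => ‖A i.castSucc (Fin.last n)‖ ^ 2)
      (fun _ _ => sq_nonneg _) (Finset.mem_univ i)
  induction i using Fin.lastCases with
  | last =>
    induction j using Fin.lastCases with
    | last => exact le_rfl
    | cast j =>
      have := Finset.single_le_sum (f := fun j : Fin n => ‖A (Fin.last n) j.castSucc‖ ^ 2)
        (fun _ _ => sq_nonneg _) (Finset.mem_univ j)
      rw [sum_norm_sq_row_last hA] at this
      linarith
  | cast i =>
    induction j using Fin.lastCases with
    | last => linarith [hcol i]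
    | cast j =>
      have := Finset.single_le_sum (f := fun j : Fin n => ‖A i.castSucc j.castSucc‖ ^ 2)
        (fun _ _ => sq_nonneg _) (Finset.mem_univ j)
      rw [sum_norm_sq_row_castSucc hA] at this
      linarith [hcol i]

/-- A reversed triangle inequality obtained from Cauchy-Schwarz. -/
lemma mul_one_sub_le_norm_sum_add {p r : Fin n → ℂ} {q : ℂ} {ρ : ℝ} (hρ : 0 ≤ ρ)
    (hp : ∑ i, ‖p i‖ ^ 2 ≤ ‖q‖ ^ 2) (hr : ∑ i, ‖r i‖ ^ 2 ≤ ρ ^ 2) :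
    ‖q‖ * (1 - ρ) ≤ ‖∑ i, p i * r i + q‖ := by
  have h1 : ‖∑ i, p i * r i‖ ≤ ‖q‖ * ρ := by
    calc ‖∑ i, p i * r i‖ ≤ ∑ i, ‖p i‖ * ‖r i‖ := by
          simpa only [norm_mul] using norm_sum_le Finset.univ fun i => p i * r i
      _ ≤ √(∑ i, ‖p i‖ ^ 2) * √(∑ i, ‖r i‖ ^ 2) := Real.sum_mul_le_sqrt_mul_sqrt _ _ _
      _ ≤ ‖q‖ * ρ := by
          gcongr
          · exact (Real.sqrt_le_sqrt hp).trans_eq (Real.sqrt_sq (norm_nonneg _))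
          · exact (Real.sqrt_le_sqrt hr).trans_eq (Real.sqrt_sq hρ)
  have h2 : ‖q‖ ≤ ‖∑ i, p i * r i + q‖ + ‖∑ i, p i * r i‖ := by
    simpa using norm_sub_le (∑ i, p i * r i + q) (∑ i, p i * r i)
  linarith

lemma snoc1_castSucc (z : Fin n → ℂ) (i : Fin n) : snoc1 z i.castSucc = z i := by
  simp [snoc1]

lemma snoc1_last (z : Fin n → ℂ) : snoc1 z (Fin.last n) = 1 := by
  simp [snoc1]

lemma mulVec_snoc1_last (A : Matrix (Fin (n + 1)) (Fin (n + 1)) ℂ) (z : Fin n → ℂ) :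
    (A *ᵥ snoc1 z) (Fin.last n) = denom A z := by
  simp [Matrix.mulVec, dotProduct, Fin.sum_univ_castSucc, snoc1_castSucc, snoc1_last, denom]

lemma mulVec_snoc1_castSucc (A : Matrix (Fin (n + 1)) (Fin (n + 1)) ℂ) (z : Fin n → ℂ)
    (i : Fin n) : (A *ᵥ snoc1 z) i.castSucc =
      ∑ l : Fin n, A i.castSucc l.castSucc * z l + A i.castSucc (Fin.last n) := by
  simp [Matrix.mulVec, dotProduct, Fin.sum_univ_castSucc, snoc1_castSucc, snoc1_last]

lemma mulVec_snoc1 {A : Matrix (Fin (n + 1)) (Fin (n + 1)) ℂ} {z : Fin n → ℂ}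
    (h : denom A z ≠ 0) : A *ᵥ snoc1 z = denom A z • snoc1 (act A z) := by
  ext i
  induction i using Fin.lastCases with
  | last => simp [mulVec_snoc1_last, snoc1_last]
  | cast i =>
    rw [mulVec_snoc1_castSucc, Pi.smul_apply, snoc1_castSucc, smul_eq_mul, act,
      mul_div_cancel₀ _ h]

lemma herm_smul_left (c : ℂ) (u v : Fin (n + 1) → ℂ) : herm (c • u) v = c * herm u v := by
  simp [herm, Finset.mul_sum, mul_sub, mul_assoc]

lemma herm_smul_self (c : ℂ) (u : Fin (n + 1) → ℂ) :
    herm (c • u) (c • u) = (‖c‖ ^ 2 : ℝ) * herm u u := by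
  rw [herm_self, herm_self]
  simp only [Pi.smul_apply, smul_eq_mul, norm_mul, mul_pow, ← Finset.mul_sum]
  push_cast
  ring

lemma herm_snoc1 (z w : Fin n → ℂ) : herm (snoc1 z) (snoc1 w) = pair z w := by
  simp [herm, pair, snoc1_castSucc, snoc1_last]

lemma herm_snoc1_self (z : Fin n → ℂ) :
    herm (snoc1 z) (snoc1 z) = ((∑ i, ‖z i‖ ^ 2 - 1 : ℝ) : ℂ) := by
  rw [herm_self]; simp [snoc1_castSucc, snoc1_last]

/-- The lower bound of the automorphy denominator. -/
lemma le_norm_denom {A : Matrix (Fin (n + 1)) (Fin (n + 1)) ℂ}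
    (hA : ∀ u v, herm (A *ᵥ u) (A *ᵥ v) = herm u v) {z : Fin n → ℂ} {ρ : ℝ} (hρ : 0 ≤ ρ)
    (hz : ∑ i, ‖z i‖ ^ 2 ≤ ρ ^ 2) :
    ‖A (Fin.last n) (Fin.last n)‖ * (1 - ρ) ≤ ‖denom A z‖ :=
  mul_one_sub_le_norm_sum_add hρ (by rw [sum_norm_sq_row_last hA]; linarith) hz

lemma exists_radius {z : Fin n → ℂ} (hz : z ∈ ball n) :
    ∃ ρ : ℝ, 0 ≤ ρ ∧ ρ < 1 ∧ ∑ i, ‖z i‖ ^ 2 ≤ ρ ^ 2 := by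
  have h0 : 0 ≤ ∑ i, ‖z i‖ ^ 2 := by positivity
  refine ⟨√(∑ i, ‖z i‖ ^ 2), Real.sqrt_nonneg _, ?_, (Real.sq_sqrt h0).ge⟩
  rw [Real.sqrt_lt' one_pos]
  rw [one_pow]
  exact hz

lemma denom_ne_zero {A : Matrix (Fin (n + 1)) (Fin (n + 1)) ℂ}
    (hA : ∀ u v, herm (A *ᵥ u) (A *ᵥ v) = herm u v) {z : Fin n → ℂ} (hz : z ∈ ball n) :
    denom A z ≠ 0 := by
  obtain ⟨ρ, h0, h1, hρ⟩ := exists_radius hz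
  have h := le_norm_denom hA h0 hρ
  have h2 := one_le_norm_last_last hA
  rw [← norm_pos_iff]
  exact lt_of_lt_of_le (mul_pos (by linarith) (by linarith)) h

lemma act_mem_ball {A : Matrix (Fin (n + 1)) (Fin (n + 1)) ℂ}
    (hA : ∀ u v, herm (A *ᵥ u) (A *ᵥ v) = herm u v) {z : Fin n → ℂ} (hz : z ∈ ball n) :
    act A z ∈ ball n := by
  have hd := denom_ne_zero hA hz
  have h := hA (snoc1 z) (snoc1 z)
  rw [mulVec_snoc1 hd, herm_smul_self, herm_snoc1_self, herm_snoc1_self, ← Complex.ofReal_mul]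
    at h
  have h' := Complex.ofReal_injective h
  have hz' : ∑ i, ‖z i‖ ^ 2 < 1 := hz
  have hp : 0 < ‖denom A z‖ ^ 2 := by positivity
  change ∑ i, ‖act A z i‖ ^ 2 < 1
  by_contra! hc
  nlinarith [mul_nonneg hp.le (sub_nonneg.mpr hc)]

lemma herm_mulVec_snoc1 {A : Matrix (Fin (n + 1)) (Fin (n + 1)) ℂ} {z : Fin n → ℂ}
    (h : denom A z ≠ 0) (w : Fin n → ℂ) :
    herm (A *ᵥ snoc1 z) (snoc1 w) = denom A z * pair (act A z) w := by
  rw [mulVec_snoc1 h, herm_smul_left, herm_snoc1]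

/-- The lower bound of the form that appears in the terms of the Poincaré series. -/
lemma le_norm_herm {A : Matrix (Fin (n + 1)) (Fin (n + 1)) ℂ}
    (hA : ∀ u v, herm (A *ᵥ u) (A *ᵥ v) = herm u v) {z w : Fin n → ℂ} {ρ τ : ℝ}
    (hρ : 0 ≤ ρ) (hρ1 : ρ < 1) (hτ : 0 ≤ τ) (hτ1 : τ < 1)
    (hz : ∑ i, ‖z i‖ ^ 2 ≤ ρ ^ 2) (hw : ∑ i, ‖w i‖ ^ 2 ≤ τ ^ 2) :
    ‖A (Fin.last n) (Fin.last n)‖ * (1 - ρ) * (1 - τ) ≤ ‖herm (A *ᵥ snoc1 z) (snoc1 w)‖ := by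
  have hz1 : z ∈ ball n := show ∑ i, ‖z i‖ ^ 2 < 1 by nlinarith
  have hd := denom_ne_zero hA hz1
  have hact : ∑ i, ‖act A z i‖ ^ 2 < 1 := act_mem_ball hA hz1
  rw [herm_mulVec_snoc1 hd, norm_mul]
  have h1 : 1 - τ ≤ ‖pair (act A z) w‖ := by
    have := mul_one_sub_le_norm_sum_add (p := act A z) (r := fun i => -star (w i)) (q := 1) hτ
      (by simpa using hact.le) (by simpa using hw)
    rw [norm_one, one_mul] at this
    have e : ∑ i, act A z i * -star (w i) + 1 = -pair (act A z) w := by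
      rw [pair, neg_sub, sub_eq_add_neg, add_comm]
      simp only [mul_neg, Finset.sum_neg_distrib]
    rwa [e, norm_neg] at this
  exact mul_le_mul (le_norm_denom hA hρ hz) h1 (by linarith) (norm_nonneg _)

end

end BallPaper

namespace BallPaper

noncomputable section

variable {n : ℕ}

lemma DiscreteGroup.herm_mulVec (G : DiscreteGroup n) {A : Matrix (Fin (n + 1)) (Fin (n + 1)) ℂ}
    (hA : A ∈ G.Γ) (u v : Fin (n + 1) → ℂ) : herm (A *ᵥ u) (A *ᵥ v) = herm u v :=
  (G.sub_SU hA).2 u v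

lemma DiscreteGroup.det_eq_one (G : DiscreteGroup n) {A : Matrix (Fin (n + 1)) (Fin (n + 1)) ℂ}
    (hA : A ∈ G.Γ) : A.det = 1 :=
  (G.sub_SU hA).1

lemma DiscreteGroup.mul_inv (G : DiscreteGroup n) {A : Matrix (Fin (n + 1)) (Fin (n + 1)) ℂ}
    (hA : A ∈ G.Γ) : A * A⁻¹ = 1 :=
  Matrix.mul_nonsing_inv _ (by simp [G.det_eq_one hA])

lemma DiscreteGroup.inv_mul (G : DiscreteGroup n) {A : Matrix (Fin (n + 1)) (Fin (n + 1)) ℂ}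
    (hA : A ∈ G.Γ) : A⁻¹ * A = 1 :=
  Matrix.nonsing_inv_mul _ (by simp [G.det_eq_one hA])

lemma DiscreteGroup.finite_norm_last_last_le (G : DiscreteGroup n) (R : ℝ) :
    {A ∈ G.Γ | ‖A (Fin.last n) (Fin.last n)‖ ≤ R}.Finite := by
  by_contra hinf
  set S := {A ∈ G.Γ | ‖A (Fin.last n) (Fin.last n)‖ ≤ R} with hS
  have hK : IsCompact {A : Matrix (Fin (n + 1)) (Fin (n + 1)) ℂ | ∀ i j, ‖A i j‖ ≤ R} := by
    have h : IsCompact (Set.univ.pi fun _ : Fin (n + 1) => Set.univ.pi fun _ : Fin (n + 1) =>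
        Metric.closedBall (0 : ℂ) R) :=
      isCompact_univ_pi fun _ => isCompact_univ_pi fun _ => isCompact_closedBall _ _
    have e : {A : Matrix (Fin (n + 1)) (Fin (n + 1)) ℂ | ∀ i j, ‖A i j‖ ≤ R} =
        (Set.univ.pi fun _ : Fin (n + 1) => Set.univ.pi fun _ : Fin (n + 1) =>
          Metric.closedBall (0 : ℂ) R : Set (Fin (n + 1) → Fin (n + 1) → ℂ)) :=
      Set.ext fun A => ⟨fun h i _ j _ => mem_closedBall_zero_iff.mpr (h i j),
        fun h i j => mem_closedBall_zero_iff.mp (h i trivial j trivial)⟩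
    rw [e]
    exact h
  have hK' := hK.inter_right (t := {A : Matrix (Fin (n + 1)) (Fin (n + 1)) ℂ | A.det = 1})
    (isClosed_eq (continuous_id.matrix_det) continuous_const)
  obtain ⟨P, ⟨-, hP⟩, hacc⟩ := Set.Infinite.exists_accPt_of_subset_isCompact hinf hK'
    fun A hA => ⟨fun i j => (norm_entry_le (G.herm_mulVec hA.1) i j).trans hA.2,
      G.det_eq_one hA.1⟩
  obtain ⟨U, hU, hU1⟩ : ∃ U ∈ 𝓝 (1 : Matrix (Fin (n + 1)) (Fin (n + 1)) ℂ),
      ∀ A ∈ G.Γ, A ∈ U → A = 1 := by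
    have := G.discrete
    obtain ⟨U, hU, hsub⟩ := (mem_nhds_subtype G.Γ ⟨1, G.one_mem⟩ {⟨1, G.one_mem⟩}).mp
      (mem_nhds_discrete.mpr rfl)
    exact ⟨U, hU, fun A hA hAU => congrArg Subtype.val (hsub (a := ⟨A, hA⟩) hAU)⟩
  have hcont : Continuous fun q : Matrix (Fin (n + 1)) (Fin (n + 1)) ℂ ×
      Matrix (Fin (n + 1)) (Fin (n + 1)) ℂ => q.1.adjugate * q.2 :=
    continuous_fst.matrix_adjugate.matrix_mul continuous_snd
  have hPP : P.adjugate * P = 1 := by rw [Matrix.adjugate_mul, hP, one_smul]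
  have hmem := hcont.continuousAt (x := (P, P)) (hPP.symm ▸ hU)
  rw [nhds_prod_eq] at hmem
  obtain ⟨V, hV, hVU⟩ := Filter.mem_prod_same_iff.mp hmem
  rw [accPt_iff_nhds] at hacc
  obtain ⟨A, ⟨hAV, hAS⟩, hAP⟩ := hacc V hV
  obtain ⟨B, ⟨⟨hBV, hBA⟩, hBS⟩, -⟩ := hacc (V ∩ {A}ᶜ)
    (inter_mem hV (isOpen_compl_singleton.mem_nhds hAP.symm))
  have hinv : A.adjugate = A⁻¹ := by
    rw [Matrix.inv_def, G.det_eq_one hAS.1, Ring.inverse_one, one_smul]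
  have h1 : A⁻¹ * B = 1 := by
    refine hU1 _ (G.mul_mem (G.inv_mem hAS.1) hBS.1) ?_
    have h2 := hVU (Set.mk_mem_prod hAV hBV)
    rwa [Set.mem_preimage, hinv] at h2
  apply hBA
  calc B = A * (A⁻¹ * B) := by rw [← Matrix.mul_assoc, G.mul_inv hAS.1, Matrix.one_mul]
    _ = A := by rw [h1, Matrix.mul_one]

/-- A truncated open cone around the last coordinate axis. -/
def truncCone (n : ℕ) : Set (Fin (n + 1) → ℂ) :=
  {v | ∑ i : Fin n, ‖v i.castSucc‖ ^ 2 < ‖v (Fin.last n)‖ ^ 2 / 4 ∧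
    1 < ‖v (Fin.last n)‖ ∧ ‖v (Fin.last n)‖ < 2}

lemma isOpen_truncCone : IsOpen (truncCone n) := by
  have h1 : Continuous fun v : Fin (n + 1) → ℂ => ∑ i : Fin n, ‖v i.castSucc‖ ^ 2 := by fun_prop
  have h2 : Continuous fun v : Fin (n + 1) → ℂ => ‖v (Fin.last n)‖ := by fun_prop
  exact (isOpen_lt h1 ((h2.pow 2).div_const 4)).inter
    ((isOpen_lt continuous_const h2).inter (isOpen_lt h2 continuous_const))

lemma nonempty_truncCone : (truncCone n).Nonempty := by
  refine ⟨Pi.single (Fin.last n) (3 / 2), ?_⟩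
  simp only [truncCone, Set.mem_ofPred_eq, Pi.single_eq_same,
    Pi.single_eq_of_ne (Fin.castSucc_ne_last _)]
  norm_num

lemma norm_le_two_of_mem_truncCone {v : Fin (n + 1) → ℂ} (hv : v ∈ truncCone n)
    (i : Fin (n + 1)) : ‖v i‖ ≤ 2 := by
  obtain ⟨h1, h2, h3⟩ := hv
  induction i using Fin.lastCases with
  | last => exact h3.le
  | cast i =>
    have := Finset.single_le_sum (f := fun i : Fin n => ‖v i.castSucc‖ ^ 2)
      (fun _ _ => sq_nonneg _) (Finset.mem_univ i)
    nlinarith [norm_nonneg (v i.castSucc)]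

/-- A matrix preserving the form which maps a point of the truncated cone to a multiple of
another one has a bounded corner entry. -/
lemma norm_last_last_le_of_mulVec_eq_smul {D : Matrix (Fin (n + 1)) (Fin (n + 1)) ℂ}
    (hD : ∀ u v, herm (D *ᵥ u) (D *ᵥ v) = herm u v) {s s' : Fin (n + 1) → ℂ}
    (hs : s ∈ truncCone n) (hs' : s' ∈ truncCone n) {t : ℂ} (h : D *ᵥ s = t • s') :
    ‖D (Fin.last n) (Fin.last n)‖ ≤ 12 := by
  have h1 := hD s s
  rw [h, herm_smul_self, herm_self, herm_self, ← Complex.ofReal_mul] at h1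
  have h2 := Complex.ofReal_injective h1
  obtain ⟨a1, a2, a3⟩ := hs
  obtain ⟨b1, b2, b3⟩ := hs'
  have p1 : 0 ≤ ∑ i : Fin n, ‖s i.castSucc‖ ^ 2 := by positivity
  have ht : ‖t‖ ≤ 3 := by
    have : ‖t‖ ^ 2 * (3 / 4) ≤ 4 := by
      nlinarith [mul_nonneg (sq_nonneg ‖t‖)
        (show 0 ≤ -(3 / 4) - (∑ i : Fin n, ‖s' i.castSucc‖ ^ 2 - ‖s' (Fin.last n)‖ ^ 2) by
          nlinarith)]
    nlinarith [norm_nonneg t]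
  have h3 : ‖D (Fin.last n) (Fin.last n) * s (Fin.last n)‖ * (1 - 1 / 2) ≤
      ‖(D *ᵥ s) (Fin.last n)‖ := by
    have := mul_one_sub_le_norm_sum_add (ρ := 1 / 2) (by norm_num)
      (p := fun j : Fin n => D (Fin.last n) j.castSucc * s (Fin.last n))
      (r := fun j : Fin n => s j.castSucc / s (Fin.last n))
      (q := D (Fin.last n) (Fin.last n) * s (Fin.last n)) (by
        simp only [norm_mul, mul_pow, ← Finset.sum_mul, sum_norm_sq_row_last hD]
        nlinarith [sq_nonneg ‖s (Fin.last n)‖]) (by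
        simp only [norm_div, div_pow, ← Finset.sum_div]
        rw [div_le_iff₀ (by positivity)]
        linarith)
    convert this using 2
    have hs0 : s (Fin.last n) ≠ 0 := norm_pos_iff.mp (by linarith)
    simp only [Matrix.mulVec, dotProduct, Fin.sum_univ_castSucc]
    congr 1
    refine Finset.sum_congr rfl fun j _ => ?_
    field_simp
  rw [h, Pi.smul_apply, smul_eq_mul, norm_mul, norm_mul] at h3
  nlinarith [norm_nonneg (D (Fin.last n) (Fin.last n)), norm_nonneg t]

lemma norm_mulVec_apply_le {A : Matrix (Fin (n + 1)) (Fin (n + 1)) ℂ} {v : Fin (n + 1) → ℂ}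
    {a b : ℝ} (hA : ∀ i j, ‖A i j‖ ≤ a) (hv : ∀ j, ‖v j‖ ≤ b) (i : Fin (n + 1)) :
    ‖(A *ᵥ v) i‖ ≤ (n + 1) * (a * b) := by
  calc ‖(A *ᵥ v) i‖ ≤ ∑ j, ‖A i j * v j‖ := by
        simpa only [Matrix.mulVec, dotProduct] using
          norm_sum_le Finset.univ fun j => A i j * v j
    _ ≤ ∑ _j : Fin (n + 1), a * b := by
        refine Finset.sum_le_sum fun j _ => ?_
        rw [norm_mul]
        exact mul_le_mul (hA i j) (hv j) (norm_nonneg _) ((norm_nonneg _).trans (hA i j))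
    _ = (n + 1) * (a * b) := by simp

/-- The normalized inverse of a group element, as a real-linear map. -/
def normInv (A : Matrix (Fin (n + 1)) (Fin (n + 1)) ℂ) :
    (Fin (n + 1) → ℂ) →ₗ[ℝ] (Fin (n + 1) → ℂ) :=
  (Matrix.toLin' ((‖A (Fin.last n) (Fin.last n)‖ : ℂ) • A⁻¹)).restrictScalars ℝ

lemma normInv_apply (A : Matrix (Fin (n + 1)) (Fin (n + 1)) ℂ) (u : Fin (n + 1) → ℂ) :
    normInv A u = (‖A (Fin.last n) (Fin.last n)‖ : ℂ) • (A⁻¹ *ᵥ u) := by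
  simp [normInv, Matrix.smul_mulVec]

lemma det_normInv {A : Matrix (Fin (n + 1)) (Fin (n + 1)) ℂ} (hA : A.det = 1) :
    LinearMap.det (normInv A) = ‖A (Fin.last n) (Fin.last n)‖ ^ (2 * (n + 1)) := by
  rw [normInv, LinearMap.det_restrictScalars, LinearMap.det_toLin', Matrix.det_smul,
    Matrix.det_nonsing_inv, hA, Ring.inverse_one, mul_one, Algebra.norm_complex_eq]
  simp [Complex.normSq_eq_norm_sq, ← pow_mul, mul_comm]

/-- The Poincaré series of exponent two converges: the truncated cone has finite volume, and
its normalized translates overlap with bounded multiplicity in a bounded region. -/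
lemma DiscreteGroup.summable_inv_norm_last_last (G : DiscreteGroup n) :
    Summable fun A : ↥G.Γ => ‖A.1 (Fin.last n) (Fin.last n)‖⁻¹ ^ (2 * (n + 1)) := by
  classical
  set F := (G.finite_norm_last_last_le 12).toFinset with hF
  set P : ↥G.Γ → Set (Fin (n + 1) → ℂ) := fun A => normInv A.1 ⁻¹' truncCone n with hP
  have hpos : ∀ A : ↥G.Γ, 0 < ‖A.1 (Fin.last n) (Fin.last n)‖ := fun A =>
    one_pos.trans_le (one_le_norm_last_last (G.herm_mulVec A.2))
  have hvol : ∀ A : ↥G.Γ, volume (P A) =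
      ENNReal.ofReal (‖A.1 (Fin.last n) (Fin.last n)‖⁻¹ ^ (2 * (n + 1))) *
        volume (truncCone n) := by
    intro A
    have hdet := det_normInv (G.det_eq_one A.2)
    rw [hP, Measure.addHaar_preimage_linearMap _ (by rw [hdet]; exact pow_ne_zero _ (hpos A).ne'),
      hdet, abs_of_nonneg (by positivity), inv_pow]
  have hmeas : ∀ A, MeasurableSet (P A) := fun A =>
    (isOpen_truncCone.preimage (LinearMap.continuous_of_finiteDimensional _)).measurableSet
  have hsub : ∀ A, P A ⊆ Metric.closedBall 0 ((n + 1) * 2) := by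
    intro A u hu
    have hu' : normInv A.1 u ∈ truncCone n := hu
    have hsol : u = ((‖A.1 (Fin.last n) (Fin.last n)‖⁻¹ : ℝ) : ℂ) • (A.1 *ᵥ normInv A.1 u) := by
      rw [normInv_apply, Matrix.mulVec_smul, Matrix.mulVec_mulVec, G.mul_inv A.2,
        Matrix.one_mulVec, smul_smul, ← Complex.ofReal_mul, inv_mul_cancel₀ (hpos A).ne',
        Complex.ofReal_one, one_smul]
    rw [mem_closedBall_zero_iff, pi_norm_le_iff_of_nonneg (by positivity)]
    intro i
    rw [hsol, Pi.smul_apply, norm_smul, Complex.norm_real, norm_inv, norm_norm]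
    have := norm_mulVec_apply_le (norm_entry_le (G.herm_mulVec A.2))
      (norm_le_two_of_mem_truncCone hu') i
    rw [inv_mul_le_iff₀ (hpos A)]
    linarith
  have hcount : ∀ (s : Finset ↥G.Γ) (u : Fin (n + 1) → ℂ), (s.filter fun A => u ∈ P A).card ≤
      F.card := by
    intro s u
    rcases (s.filter fun A => u ∈ P A).eq_empty_or_nonempty with h0 | ⟨B, hB⟩
    · simp [h0]
    refine Finset.card_le_card_of_injOn (fun A => B.1⁻¹ * A.1) (fun A hA => ?_)
      fun A _ A' _ h => ?_
    · have hAu : normInv A.1 u ∈ truncCone n := (Finset.mem_filter.mp hA).2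
      have hBu : normInv B.1 u ∈ truncCone n := (Finset.mem_filter.mp hB).2
      have hmem : B.1⁻¹ * A.1 ∈ G.Γ := G.mul_mem (G.inv_mem B.2) A.2
      rw [hF, Set.Finite.coe_toFinset]
      refine ⟨hmem, norm_last_last_le_of_mulVec_eq_smul (G.herm_mulVec hmem) hAu hBu
        (t := (‖A.1 (Fin.last n) (Fin.last n)‖ : ℂ) *
          (‖B.1 (Fin.last n) (Fin.last n)‖ : ℂ)⁻¹) ?_⟩
      have hB0 : (‖B.1 (Fin.last n) (Fin.last n)‖ : ℂ) ≠ 0 := by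
        exact_mod_cast (hpos B).ne'
      rw [normInv_apply, normInv_apply, Matrix.mulVec_smul, Matrix.mulVec_mulVec,
        Matrix.mul_assoc, G.mul_inv A.2, Matrix.mul_one, smul_smul, inv_mul_cancel_right₀ hB0]
    · have h' := congrArg (fun M => B.1 * M) h
      simp only [← Matrix.mul_assoc, G.mul_inv B.2, Matrix.one_mul] at h'
      exact Subtype.ext h'
  have hS0 : volume (truncCone n) ≠ 0 :=
    (isOpen_truncCone.measure_pos volume nonempty_truncCone).ne'
  have hStop : volume (truncCone n) ≠ ⊤ := by
    refine ((measure_mono (t := Metric.closedBall 0 2) fun v hv => ?_).trans_lt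
      measure_closedBall_lt_top).ne
    rw [mem_closedBall_zero_iff, pi_norm_le_iff_of_nonneg two_pos.le]
    exact norm_le_two_of_mem_truncCone hv
  set M := (F.card : ENNReal) *
    volume (Metric.closedBall (0 : Fin (n + 1) → ℂ) ((n + 1) * 2)) with hM
  have hMtop : M ≠ ⊤ :=
    ENNReal.mul_ne_top (ENNReal.natCast_ne_top _) measure_closedBall_lt_top.ne
  have hsum : ∀ s : Finset ↥G.Γ, ∑ A ∈ s, volume (P A) ≤ M := by
    intro s
    calc ∑ A ∈ s, volume (P A) = ∫⁻ u, ∑ A ∈ s, (P A).indicator 1 u := by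
          rw [lintegral_finsetSum _ fun A _ => measurable_one.indicator (hmeas A)]
          exact Finset.sum_congr rfl fun A _ => (lintegral_indicator_one (hmeas A)).symm
      _ ≤ ∫⁻ u, (Metric.closedBall (0 : Fin (n + 1) → ℂ) ((n + 1) * 2)).indicator
            (fun _ => (F.card : ENNReal)) u := by
          refine lintegral_mono fun u => ?_
          by_cases hu : u ∈ Metric.closedBall (0 : Fin (n + 1) → ℂ) ((n + 1) * 2)
          · simp only [Set.indicator_of_mem hu, Set.indicator_apply, Pi.one_apply,
              Finset.sum_boole]
            exact_mod_cast hcount s u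
          · simp only [Set.indicator_of_notMem hu]
            exact (Finset.sum_eq_zero fun A _ =>
              Set.indicator_of_notMem (fun h => hu (hsub A h)) _).le
      _ = M := by
          rw [lintegral_indicator Metric.isClosed_closedBall.measurableSet,
            setLIntegral_const]
  refine summable_of_sum_le (c := (M / volume (truncCone n)).toReal) (fun _ => by positivity)
    fun s => ?_
  rw [← ENNReal.ofReal_le_iff_le_toReal (ENNReal.div_ne_top hMtop hS0),
    ENNReal.le_div_iff_mul_le (Or.inl hS0) (Or.inl hStop),
    ENNReal.ofReal_sum_of_nonneg fun _ _ => by positivity, Finset.sum_mul]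
  simpa only [hvol] using hsum s

lemma DiscreteGroup.summable_inv_norm_last_last_pow (G : DiscreteGroup n) {m : ℕ}
    (hm : 2 * (n + 1) ≤ m) :
    Summable fun A : ↥G.Γ => ‖A.1 (Fin.last n) (Fin.last n)‖⁻¹ ^ m :=
  G.summable_inv_norm_last_last.of_nonneg_of_le (fun _ => by positivity) fun A =>
    pow_le_pow_of_le_one (by positivity)
      (inv_le_one_of_one_le₀ (one_le_norm_last_last (G.herm_mulVec A.2))) hm

end

end BallPaper

namespace BallPaper

noncomputable section

variable {n : ℕ}

/-- The coefficients of the affine form `z ↦ herm (A (z, 1)) (w, 1)`. -/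
def formCoeff (A : Matrix (Fin (n + 1)) (Fin (n + 1)) ℂ) (w : Fin n → ℂ) (j : Fin (n + 1)) : ℂ :=
  ∑ i : Fin n, A i.castSucc j * star (w i) - A (Fin.last n) j

/-- The linear part of the affine form `z ↦ herm (A (z, 1)) (w, 1)`. -/
def formLin (A : Matrix (Fin (n + 1)) (Fin (n + 1)) ℂ) (w : Fin n → ℂ) : (Fin n → ℂ) →L[ℂ] ℂ :=
  ∑ j : Fin n, formCoeff A w j.castSucc • ContinuousLinearMap.proj j

lemma herm_mulVec_snoc1_eq (A : Matrix (Fin (n + 1)) (Fin (n + 1)) ℂ) (w z : Fin n → ℂ) :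
    herm (A *ᵥ snoc1 z) (snoc1 w) = formLin A w z + formCoeff A w (Fin.last n) := by
  simp only [herm, mulVec_snoc1_last, mulVec_snoc1_castSucc, snoc1_castSucc, snoc1_last, denom,
    formLin, formCoeff, _root_.sum_apply, _root_.smul_apply,
    ContinuousLinearMap.proj_apply, smul_eq_mul, star_one, mul_one, sub_mul, add_mul,
    Finset.sum_add_distrib, Finset.sum_sub_distrib, Finset.sum_mul]
  rw [Finset.sum_comm]
  simp only [mul_right_comm]
  ring

lemma norm_formCoeff_le {A : Matrix (Fin (n + 1)) (Fin (n + 1)) ℂ}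
    (hA : ∀ u v, herm (A *ᵥ u) (A *ᵥ v) = herm u v) {w : Fin n → ℂ} (hw : w ∈ ball n)
    (j : Fin (n + 1)) :
    ‖formCoeff A w j‖ ≤ (n + 1) * ‖A (Fin.last n) (Fin.last n)‖ := by
  have hw1 : ∀ i, ‖w i‖ ≤ 1 := by
    intro i
    have h1 : ‖w i‖ ^ 2 ≤ ∑ i, ‖w i‖ ^ 2 := Finset.single_le_sum (f := fun i => ‖w i‖ ^ 2)
      (fun _ _ => sq_nonneg _) (Finset.mem_univ i)
    have h2 : ∑ i, ‖w i‖ ^ 2 < 1 := hw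
    nlinarith [norm_nonneg (w i)]
  have h1 : ‖∑ i : Fin n, A i.castSucc j * star (w i)‖ ≤
      n * ‖A (Fin.last n) (Fin.last n)‖ := by
    calc ‖∑ i : Fin n, A i.castSucc j * star (w i)‖
        ≤ ∑ i : Fin n, ‖A i.castSucc j * star (w i)‖ := norm_sum_le _ _
      _ ≤ ∑ _i : Fin n, ‖A (Fin.last n) (Fin.last n)‖ := by
          refine Finset.sum_le_sum fun i _ => ?_
          rw [norm_mul, norm_star]
          exact (mul_le_of_le_one_right (norm_nonneg _) (hw1 i)).trans (norm_entry_le hA _ _)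
      _ = n * ‖A (Fin.last n) (Fin.last n)‖ := by simp
  calc ‖formCoeff A w j‖ ≤ _ := norm_sub_le _ _
    _ ≤ n * ‖A (Fin.last n) (Fin.last n)‖ + ‖A (Fin.last n) (Fin.last n)‖ :=
        add_le_add h1 (norm_entry_le hA _ _)
    _ = _ := by ring

lemma norm_formLin_le {A : Matrix (Fin (n + 1)) (Fin (n + 1)) ℂ}
    (hA : ∀ u v, herm (A *ᵥ u) (A *ᵥ v) = herm u v) {w : Fin n → ℂ} (hw : w ∈ ball n) :
    ‖formLin A w‖ ≤ n * ((n + 1) * ‖A (Fin.last n) (Fin.last n)‖) := by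
  refine ContinuousLinearMap.opNorm_le_bound _ (by positivity) fun v => ?_
  simp only [formLin, _root_.sum_apply, _root_.smul_apply,
    ContinuousLinearMap.proj_apply, smul_eq_mul]
  calc ‖∑ j : Fin n, formCoeff A w j.castSucc * v j‖
      ≤ ∑ j : Fin n, ‖formCoeff A w j.castSucc * v j‖ := norm_sum_le _ _
    _ ≤ ∑ _j : Fin n, (n + 1) * ‖A (Fin.last n) (Fin.last n)‖ * ‖v‖ := by
        refine Finset.sum_le_sum fun j _ => ?_
        rw [norm_mul]
        exact mul_le_mul (norm_formCoeff_le hA hw _) (norm_le_pi_norm v j) (norm_nonneg _)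
          (by positivity)
    _ = _ := by simp [mul_assoc]

lemma continuous_formCoeff (A : Matrix (Fin (n + 1)) (Fin (n + 1)) ℂ) (j : Fin (n + 1)) :
    Continuous fun w => formCoeff A w j := by
  unfold formCoeff
  fun_prop

lemma continuous_formLin (A : Matrix (Fin (n + 1)) (Fin (n + 1)) ℂ) :
    Continuous (formLin A) :=
  continuous_finsetSum _ fun j _ => (continuous_formCoeff A j.castSucc).smul continuous_const

lemma continuous_herm_mulVec_snoc1 (A : Matrix (Fin (n + 1)) (Fin (n + 1)) ℂ) (z : Fin n → ℂ) :
    Continuous fun w => herm (A *ᵥ snoc1 z) (snoc1 w) := by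
  simp only [herm_mulVec_snoc1_eq]
  exact ((continuous_formLin A).clm_apply continuous_const).add (continuous_formCoeff A _)

/-- The normalized term of the Poincaré series. -/
def seriesTerm (m : ℕ) (A : Matrix (Fin (n + 1)) (Fin (n + 1)) ℂ) (w z : Fin n → ℂ) : ℂ :=
  (-herm (A *ᵥ snoc1 z) (snoc1 w))⁻¹ ^ m

/-- The derivative in `z` of the normalized term of the Poincaré series. -/
def seriesTermDeriv (m : ℕ) (A : Matrix (Fin (n + 1)) (Fin (n + 1)) ℂ) (w z : Fin n → ℂ) :
    (Fin n → ℂ) →L[ℂ] ℂ :=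
  ((m : ℂ) * (-herm (A *ᵥ snoc1 z) (snoc1 w))⁻¹ ^ (m + 1)) • formLin A w

lemma hasFDerivAt_seriesTerm (m : ℕ) {A : Matrix (Fin (n + 1)) (Fin (n + 1)) ℂ} {w z : Fin n → ℂ}
    (h : herm (A *ᵥ snoc1 z) (snoc1 w) ≠ 0) :
    HasFDerivAt (seriesTerm m A w) (seriesTermDeriv m A w z) z := by
  have h1 : HasFDerivAt (fun z => herm (A *ᵥ snoc1 z) (snoc1 w)) (formLin A w) z := by
    simp only [herm_mulVec_snoc1_eq]
    exact (formLin A w).hasFDerivAt.add_const _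
  have h2 : HasDerivAt (fun y : ℂ => (-y)⁻¹ ^ m)
      ((m : ℂ) * (-herm (A *ᵥ snoc1 z) (snoc1 w))⁻¹ ^ (m + 1))
      (herm (A *ᵥ snoc1 z) (snoc1 w)) := by
    refine (((hasDerivAt_neg' (herm (A *ᵥ snoc1 z) (snoc1 w))).fun_inv
      (neg_ne_zero.mpr h)).fun_pow m).congr_deriv ?_
    rcases m with _ | m
    · simp
    · rw [Nat.add_sub_cancel, pow_add _ m 2, inv_pow _ 2, neg_neg]
      ring
  have h3 := HasDerivAt.comp_hasFDerivAt (h₂ := fun y : ℂ => (-y)⁻¹ ^ m)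
    (f := fun z => herm (A *ᵥ snoc1 z) (snoc1 w)) z h2 h1
  exact h3

lemma Kc_pow_mul_jac_pow (k : ℕ) {A : Matrix (Fin (n + 1)) (Fin (n + 1)) ℂ} {z : Fin n → ℂ}
    (h : denom A z ≠ 0) (w : Fin n → ℂ) :
    Kc (act A z) w ^ k * jac A z ^ k =
      (((Nat.factorial n : ℝ) / Real.pi ^ n : ℝ) : ℂ) ^ k * seriesTerm ((n + 1) * k) A w z := by
  rw [seriesTerm, herm_mulVec_snoc1 h, Kc, jac, neg_mul_eq_mul_neg, mul_inv]
  simp only [mul_pow, ← pow_mul]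
  ring

lemma ThetaPt_eq {G : DiscreteGroup n} (k : ℕ) (w : Fin n → ℂ) {z : Fin n → ℂ}
    (hz : z ∈ ball n) :
    ThetaPt G k w z = (cB n k : ℂ) * (((Nat.factorial n : ℝ) / Real.pi ^ n : ℝ) : ℂ) ^ k *
      ∑' A : ↥G.Γ, seriesTerm ((n + 1) * k) A.1 w z := by
  rw [ThetaPt, mul_assoc]
  congr 1
  rw [← tsum_mul_left]
  exact tsum_congr fun A => Kc_pow_mul_jac_pow k (denom_ne_zero (G.herm_mulVec A.2) hz) w

lemma seriesTerm_act (m : ℕ) (A : Matrix (Fin (n + 1)) (Fin (n + 1)) ℂ)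
    {B : Matrix (Fin (n + 1)) (Fin (n + 1)) ℂ} {z : Fin n → ℂ} (h : denom B z ≠ 0)
    (w : Fin n → ℂ) :
    seriesTerm m A w (act B z) * (denom B z)⁻¹ ^ m = seriesTerm m (A * B) w z := by
  rw [seriesTerm, seriesTerm, ← Matrix.mulVec_mulVec, mulVec_snoc1 h, Matrix.mulVec_smul,
    herm_smul_left, ← mul_pow, ← mul_inv]
  ring

lemma ThetaPt_act {G : DiscreteGroup n} (k : ℕ) (w : Fin n → ℂ)
    {B : Matrix (Fin (n + 1)) (Fin (n + 1)) ℂ} (hB : B ∈ G.Γ) {z : Fin n → ℂ}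
    (hz : z ∈ ball n) :
    ThetaPt G k w (act B z) * jac B z ^ k = ThetaPt G k w z := by
  have hd := denom_ne_zero (G.herm_mulVec hB) hz
  let e : ↥G.Γ ≃ ↥G.Γ :=
    { toFun := fun A => ⟨A.1 * B, G.mul_mem A.2 hB⟩
      invFun := fun A => ⟨A.1 * B⁻¹, G.mul_mem A.2 (G.inv_mem hB)⟩
      left_inv := fun A => Subtype.ext (by simp [Matrix.mul_assoc, G.mul_inv hB])
      right_inv := fun A => Subtype.ext (by simp [Matrix.mul_assoc, G.inv_mul hB]) }
  rw [ThetaPt_eq k w hz, ThetaPt_eq k w (act_mem_ball (G.herm_mulVec hB) hz), mul_assoc,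
    jac, ← pow_mul, ← tsum_mul_right, ← e.tsum_eq fun A : ↥G.Γ => seriesTerm _ A.1 w z]
  congr 1
  exact tsum_congr fun A => seriesTerm_act _ _ hd w

lemma norm_seriesTerm_le (m : ℕ) {A : Matrix (Fin (n + 1)) (Fin (n + 1)) ℂ} {w z : Fin n → ℂ}
    {δ : ℝ} (hδ : 0 < δ) (ha : 0 < ‖A (Fin.last n) (Fin.last n)‖)
    (h : ‖A (Fin.last n) (Fin.last n)‖ * δ ≤ ‖herm (A *ᵥ snoc1 z) (snoc1 w)‖) :
    ‖seriesTerm m A w z‖ ≤ δ⁻¹ ^ m * ‖A (Fin.last n) (Fin.last n)‖⁻¹ ^ m := by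
  rw [seriesTerm, norm_pow, norm_inv, norm_neg, ← mul_pow, ← mul_inv, mul_comm δ]
  gcongr

lemma norm_seriesTermDeriv_le (m : ℕ) {A : Matrix (Fin (n + 1)) (Fin (n + 1)) ℂ}
    (hA : ∀ u v, herm (A *ᵥ u) (A *ᵥ v) = herm u v) {w z : Fin n → ℂ} (hw : w ∈ ball n)
    {δ : ℝ} (hδ : 0 < δ) (ha : 0 < ‖A (Fin.last n) (Fin.last n)‖)
    (h : ‖A (Fin.last n) (Fin.last n)‖ * δ ≤ ‖herm (A *ᵥ snoc1 z) (snoc1 w)‖) :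
    ‖seriesTermDeriv m A w z‖ ≤
      (m * δ⁻¹ ^ (m + 1) * (n * (n + 1))) * ‖A (Fin.last n) (Fin.last n)‖⁻¹ ^ m := by
  rw [seriesTermDeriv, norm_smul, norm_mul, norm_pow, norm_inv, norm_neg, Complex.norm_natCast]
  calc (m * ‖herm (A *ᵥ snoc1 z) (snoc1 w)‖⁻¹ ^ (m + 1)) * ‖formLin A w‖
      ≤ (m * (‖A (Fin.last n) (Fin.last n)‖ * δ)⁻¹ ^ (m + 1)) *
          (n * ((n + 1) * ‖A (Fin.last n) (Fin.last n)‖)) := by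
        gcongr
        exact norm_formLin_le hA hw
    _ = _ := by
        rw [mul_inv, mul_pow, pow_succ ‖A (Fin.last n) (Fin.last n)‖⁻¹]
        field_simp

lemma isOpen_ball : IsOpen (ball n) := by
  have h : Continuous fun z : Fin n → ℂ => ∑ i, ‖z i‖ ^ 2 := by fun_prop
  exact isOpen_lt h continuous_const

/-- Integrals of point Poincaré series over compact families of base points are holomorphic. -/
lemma differentiableOn_integral_ThetaPt (G : DiscreteGroup n) {k : ℕ} (hk : 2 ≤ k)
    {w : ℝ → Fin n → ℂ} {g : ℝ → ℂ} {a b : ℝ} (hw : ContinuousOn w (Set.uIcc a b))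
    (hwb : ∀ x ∈ Set.uIcc a b, w x ∈ ball n) (hg : ContinuousOn g (Set.uIcc a b)) :
    DifferentiableOn ℂ (fun z => ∫ x in a..b, ThetaPt G k (w x) z * g x) (ball n) := by
  intro z₀ hz₀
  obtain ⟨τ, hτ0, hτ1, hτ⟩ : ∃ τ : ℝ, 0 ≤ τ ∧ τ < 1 ∧
      ∀ x ∈ Set.uIcc a b, ∑ i, ‖w x i‖ ^ 2 ≤ τ ^ 2 := by
    have hc : ContinuousOn (fun x => ∑ i, ‖w x i‖ ^ 2) (Set.uIcc a b) :=
      (show Continuous fun z : Fin n → ℂ => ∑ i, ‖z i‖ ^ 2 by fun_prop).comp_continuousOn hw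
    obtain ⟨x₀, hx₀, hmax⟩ := isCompact_uIcc.exists_isMaxOn Set.nonempty_uIcc hc
    obtain ⟨τ, h0, h1, h2⟩ := exists_radius (hwb x₀ hx₀)
    exact ⟨τ, h0, h1, fun x hx => (hmax hx).trans h2⟩
  obtain ⟨ρ, hρ0, hρ1, ε, hε, hρ⟩ : ∃ ρ : ℝ, 0 ≤ ρ ∧ ρ < 1 ∧ ∃ ε > 0,
      ∀ z ∈ Metric.ball z₀ ε, ∑ i, ‖z i‖ ^ 2 ≤ ρ ^ 2 := by
    obtain ⟨r, h0, h1, h2⟩ := exists_radius hz₀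
    have hc : Continuous fun z : Fin n → ℂ => ∑ i, ‖z i‖ ^ 2 := by fun_prop
    have ho : IsOpen {z : Fin n → ℂ | ∑ i, ‖z i‖ ^ 2 < ((r + 1) / 2) ^ 2} :=
      isOpen_lt hc continuous_const
    obtain ⟨ε, hε, hsub⟩ := Metric.isOpen_iff.mp ho z₀
      (show ∑ i, ‖z₀ i‖ ^ 2 < ((r + 1) / 2) ^ 2 by nlinarith)
    exact ⟨(r + 1) / 2, by linarith, by linarith, ε, hε, fun z hz => (hsub hz).le⟩
  set m := (n + 1) * k with hm
  set δ := (1 - ρ) * (1 - τ) with hδdef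
  have hδ : 0 < δ := mul_pos (by linarith) (by linarith)
  have hpos : ∀ A : ↥G.Γ, 0 < ‖A.1 (Fin.last n) (Fin.last n)‖ := fun A =>
    one_pos.trans_le (one_le_norm_last_last (G.herm_mulVec A.2))
  have hlow : ∀ (A : ↥G.Γ), ∀ x ∈ Set.uIcc a b, ∀ z ∈ Metric.ball z₀ ε,
      ‖A.1 (Fin.last n) (Fin.last n)‖ * δ ≤ ‖herm (A.1 *ᵥ snoc1 z) (snoc1 (w x))‖ := by
    intro A x hx z hz
    rw [hδdef, ← mul_assoc]
    exact le_norm_herm (G.herm_mulVec A.2) hρ0 hρ1 hτ0 hτ1 (hρ z hz) (hτ x hx)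
  have hne : ∀ (A : ↥G.Γ), ∀ x ∈ Set.uIcc a b, ∀ z ∈ Metric.ball z₀ ε,
      herm (A.1 *ᵥ snoc1 z) (snoc1 (w x)) ≠ 0 := fun A x hx z hz =>
    norm_pos_iff.mp ((mul_pos (hpos A) hδ).trans_le (hlow A x hx z hz))
  have hsum : Summable fun A : ↥G.Γ => ‖A.1 (Fin.last n) (Fin.last n)‖⁻¹ ^ m :=
    G.summable_inv_norm_last_last_pow (by rw [hm, mul_comm 2]; gcongr)
  have hu := hsum.mul_left (δ⁻¹ ^ m)
  have hu' := hsum.mul_left (m * δ⁻¹ ^ (m + 1) * (n * (n + 1)) : ℝ)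
  have hbd : ∀ (A : ↥G.Γ), ∀ x ∈ Set.uIcc a b, ∀ z ∈ Metric.ball z₀ ε,
      ‖seriesTerm m A.1 (w x) z‖ ≤ δ⁻¹ ^ m * ‖A.1 (Fin.last n) (Fin.last n)‖⁻¹ ^ m :=
    fun A x hx z hz => norm_seriesTerm_le m hδ (hpos A) (hlow A x hx z hz)
  have hbd' : ∀ (A : ↥G.Γ), ∀ x ∈ Set.uIcc a b, ∀ z ∈ Metric.ball z₀ ε,
      ‖seriesTermDeriv m A.1 (w x) z‖ ≤ (m * δ⁻¹ ^ (m + 1) * (n * (n + 1))) *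
        ‖A.1 (Fin.last n) (Fin.last n)‖⁻¹ ^ m :=
    fun A x hx z hz => norm_seriesTermDeriv_le m (G.herm_mulVec A.2) (hwb x hx) hδ (hpos A)
      (hlow A x hx z hz)
  have hinv : ∀ (A : ↥G.Γ), ∀ z ∈ Metric.ball z₀ ε, ContinuousOn
      (fun x => (-herm (A.1 *ᵥ snoc1 z) (snoc1 (w x)))⁻¹) (Set.uIcc a b) := fun A z hz =>
    ((continuous_herm_mulVec_snoc1 A.1 z).comp_continuousOn hw).neg.inv₀ fun x hx =>
      neg_ne_zero.mpr (hne A x hx z hz)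
  have hcont : ∀ z ∈ Metric.ball z₀ ε, ContinuousOn
      (fun x => ∑' A : ↥G.Γ, seriesTerm m A.1 (w x) z) (Set.uIcc a b) := fun z hz =>
    continuousOn_tsum (fun A => (hinv A z hz).pow m) hu fun A x hx => hbd A x hx z hz
  have hcont' : ∀ z ∈ Metric.ball z₀ ε, ContinuousOn
      (fun x => ∑' A : ↥G.Γ, seriesTermDeriv m A.1 (w x) z) (Set.uIcc a b) := fun z hz =>
    continuousOn_tsum (fun A => (continuousOn_const.mul ((hinv A z hz).pow (m + 1))).smul
      ((continuous_formLin A.1).comp_continuousOn hw)) hu' fun A x hx => hbd' A x hx z hz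
  have hz₀ε : z₀ ∈ Metric.ball z₀ ε := Metric.mem_ball_self hε
  have hderiv : ∀ x ∈ Set.uIcc a b, ∀ z ∈ Metric.ball z₀ ε,
      HasFDerivAt (fun z => ∑' A : ↥G.Γ, seriesTerm m A.1 (w x) z)
        (∑' A : ↥G.Γ, seriesTermDeriv m A.1 (w x) z) z := fun x hx z hz =>
    hasFDerivAt_tsum_of_isPreconnected hu' Metric.isOpen_ball
      (convex_ball z₀ ε).isPreconnected
      (fun A y hy => hasFDerivAt_seriesTerm m (hne A x hx y hy))
      (fun A y hy => hbd' A x hx y hy) hz₀ε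
      (Summable.of_norm_bounded hu fun A => hbd A x hx z₀ hz₀ε) hz
  set c : ℂ := (cB n k : ℂ) * (((Nat.factorial n : ℝ) / Real.pi ^ n : ℝ) : ℂ) ^ k with hc
  have hcg : ContinuousOn (fun x => c * g x) (Set.uIcc a b) := continuousOn_const.mul hg
  have hsubset : Set.uIoc a b ⊆ Set.uIcc a b := Set.uIoc_subset_uIcc
  have hmain := intervalIntegral.hasFDerivAt_integral_of_dominated_of_fderiv_le
    (μ := volume) (a := a) (b := b) (𝕜 := ℂ)
    (F := fun z x => (∑' A : ↥G.Γ, seriesTerm m A.1 (w x) z) * (c * g x))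
    (F' := fun z x => (c * g x) • ∑' A : ↥G.Γ, seriesTermDeriv m A.1 (w x) z)
    (bound := fun x => ‖c * g x‖ * ∑' A : ↥G.Γ, (m * δ⁻¹ ^ (m + 1) * (n * (n + 1)) : ℝ) *
        ‖A.1 (Fin.last n) (Fin.last n)‖⁻¹ ^ m)
    (Metric.ball_mem_nhds z₀ hε)
    (Filter.eventually_of_mem (Metric.ball_mem_nhds z₀ hε) fun z hz =>
      (((hcont z hz).mul hcg).mono hsubset).aestronglyMeasurable measurableSet_uIoc)
    ((hcont z₀ hz₀ε).mul hcg).intervalIntegrable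
    (((hcg.smul (hcont' z₀ hz₀ε)).mono hsubset).aestronglyMeasurable measurableSet_uIoc)
    (Filter.Eventually.of_forall fun x hx z hz => by
      rw [norm_smul]
      gcongr
      exact tsum_of_norm_bounded hu'.hasSum fun A => hbd' A x (hsubset hx) z hz)
    (hcg.norm.mul continuousOn_const).intervalIntegrable
    (Filter.Eventually.of_forall fun x hx z hz => (hderiv x (hsubset hx) z hz).mul_const _)
  refine (hmain.congr_of_eventuallyEq ?_).differentiableAt.differentiableWithinAt
  filter_upwards [isOpen_ball.mem_nhds hz₀] with z hz
  refine intervalIntegral.integral_congr fun x _ => ?_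
  simp only [ThetaPt_eq k (w x) hz]
  ring

lemma herm_add_left (u u' v : Fin (n + 1) → ℂ) : herm (u + u') v = herm u v + herm u' v := by
  simp only [herm, Pi.add_apply, add_mul, Finset.sum_add_distrib]
  ring

lemma herm_sub_left (u u' v : Fin (n + 1) → ℂ) : herm (u - u') v = herm u v - herm u' v := by
  simp only [herm, Pi.sub_apply, sub_mul, Finset.sum_sub_distrib]
  ring

lemma star_herm (u v : Fin (n + 1) → ℂ) : star (herm u v) = herm v u := by
  simp [herm, mul_comm]

lemma herm_add_right (u v v' : Fin (n + 1) → ℂ) : herm u (v + v') = herm u v + herm u v' := by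
  rw [← star_herm, herm_add_left, star_add, star_herm, star_herm]

lemma herm_sub_right (u v v' : Fin (n + 1) → ℂ) : herm u (v - v') = herm u v - herm u v' := by
  rw [← star_herm, herm_sub_left, star_sub, star_herm, star_herm]

lemma herm_smul_right (c : ℂ) (u v : Fin (n + 1) → ℂ) :
    herm u (c • v) = star c * herm u v := by
  rw [← star_herm, herm_smul_left, star_mul', star_herm]

variable {G : DiscreteGroup n}

lemma HypElt.lam_ne_zero (H : HypElt n G) : H.lam ≠ 0 := by
  intro h
  have := H.lam_sq
  norm_num [h] at this

lemma HypElt.herm_v_eq_zero (H : HypElt n G) (j : Fin (n - 1)) {u : Fin (n + 1) → ℂ} {μ : ℝ}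
    (hμ : μ ^ 2 ≠ 1) (hu : H.γ *ᵥ u = (μ : ℂ) • u) : herm (H.v j) u = 0 := by
  have h := G.herm_mulVec H.mem (H.v j) u
  rw [hu, H.v_eig j, herm_smul_left, herm_smul_right] at h
  have hstar : star (μ : ℂ) = μ := Complex.conj_ofReal μ
  rw [hstar, ← mul_assoc] at h
  by_contra h0
  have h1 : H.alph j * (μ : ℂ) = 1 := mul_right_cancel₀ h0 (h.trans (one_mul _).symm)
  apply hμ
  have h2 : H.alph j ^ 2 = 1 := by rcases H.alph_pm j with h | h <;> simp [h]
  have h3 : (μ : ℂ) ^ 2 = 1 := by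
    have h4 : (H.alph j * (μ : ℂ)) ^ 2 = 1 := by rw [h1, one_pow]
    rwa [mul_pow, h2, one_mul] at h4
  exact_mod_cast h3

lemma HypElt.pair_ne_zero (H : HypElt n G) : pair H.X H.Y ≠ 0 := by
  intro h
  have hXY : H.X = H.Y := by
    have h1 : ∑ i, H.X i * star (H.Y i) = 1 := sub_eq_zero.mp h
    have h2 : ∑ i, ‖H.X i - H.Y i‖ ^ 2 = 0 := by
      have h3 : ∀ i, ‖H.X i - H.Y i‖ ^ 2 =
          ‖H.X i‖ ^ 2 + ‖H.Y i‖ ^ 2 - 2 * (H.X i * star (H.Y i)).re := fun i => by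
        rw [← Complex.normSq_eq_norm_sq, ← Complex.normSq_eq_norm_sq,
          ← Complex.normSq_eq_norm_sq, Complex.normSq_sub]
        rfl
      simp only [h3, Finset.sum_sub_distrib, Finset.sum_add_distrib, H.X_bd, H.Y_bd,
        ← Finset.mul_sum, ← Complex.re_sum, h1, Complex.one_re]
      norm_num
    ext i
    have := (Finset.sum_eq_zero_iff_of_nonneg fun _ _ => sq_nonneg _).mp h2 i (Finset.mem_univ i)
    simpa [sub_eq_zero] using this
  have h1 := congrFun (H.eigX.symm.trans (hXY ▸ H.eigY)) (Fin.last n)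
  simp only [Pi.smul_apply, snoc1_last, smul_eq_mul, mul_one] at h1
  have h2 : H.lam = H.lam⁻¹ := by exact_mod_cast h1
  have h3 : H.lam ^ 2 = 1 := by
    rw [sq]
    nth_rewrite 2 [h2]
    exact mul_inv_cancel₀ H.lam_ne_zero
  exact H.lam_sq.ne' h3

lemma HypElt.star_pair (H : HypElt n G) : star (pair H.X H.Y) = pair H.X H.Y := by
  have hX : ∀ i, (starRingEnd ℂ) (H.X i) = H.X i := fun i => Complex.conj_eq_iff_im.mpr (H.X_real i)
  have hY : ∀ i, (starRingEnd ℂ) (H.Y i) = H.Y i := fun i => Complex.conj_eq_iff_im.mpr (H.Y_real i)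
  simp [pair, hX, hY]

/-- The matrix `A_γ` preserves the Hermitian form. -/
lemma HypElt.herm_A_mulVec (H : HypElt n G) (hn : 0 < n) (u v : Fin (n + 1) → ℂ) :
    herm (H.A *ᵥ u) (H.A *ᵥ v) = herm u v := by
  have hp := H.pair_ne_zero
  have hXX : herm (snoc1 H.X) (snoc1 H.X) = 0 := by rw [herm_snoc1_self, H.X_bd]; simp
  have hYY : herm (snoc1 H.Y) (snoc1 H.Y) = 0 := by rw [herm_snoc1_self, H.Y_bd]; simp
  have hXY : herm (snoc1 H.X) (snoc1 H.Y) = pair H.X H.Y := herm_snoc1 _ _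
  have hYX : herm (snoc1 H.Y) (snoc1 H.X) = pair H.X H.Y := by
    rw [← star_herm, hXY, H.star_pair]
  have hvX : ∀ j, herm (H.v j) (snoc1 H.X) = 0 := fun j =>
    H.herm_v_eq_zero j H.lam_sq.ne' H.eigX
  have hvY : ∀ j, herm (H.v j) (snoc1 H.Y) = 0 := fun j =>
    H.herm_v_eq_zero j (μ := H.lam⁻¹) (by
      rw [inv_pow]
      exact fun h => H.lam_sq.ne' (inv_eq_one.mp h)) (by simpa using H.eigY)
  have hXv : ∀ j, herm (snoc1 H.X) (H.v j) = 0 := fun j => by rw [← star_herm, hvX, star_zero]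
  have hYv : ∀ j, herm (snoc1 H.Y) (H.v j) = 0 := fun j => by rw [← star_herm, hvY, star_zero]
  have hcol : ∀ j : Fin (n + 1), H.Aᵀ j =
      if h : (j : ℕ) < n - 1 then H.v ⟨j, h⟩
      else if (j : ℕ) = n - 1 then (pair H.X H.Y)⁻¹ • snoc1 H.X + (2 : ℂ)⁻¹ • snoc1 H.Y
      else (pair H.X H.Y)⁻¹ • snoc1 H.X - (2 : ℂ)⁻¹ • snoc1 H.Y := by
    intro j
    ext i
    rw [Matrix.transpose_apply, HypElt.A, Amat, Matrix.of_apply]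
    split_ifs <;> rfl
  have hgram : ∀ j l : Fin (n + 1), herm (H.Aᵀ j) (H.Aᵀ l) = sigmaM n l j := by
    intro j l
    have hj := j.isLt
    have hl := l.isLt
    have hsp : star (pair H.X H.Y)⁻¹ = (pair H.X H.Y)⁻¹ := by rw [star_inv₀, H.star_pair]
    have hs2 : star (2 : ℂ)⁻¹ = 2⁻¹ := by simp
    have hp1 : (pair H.X H.Y)⁻¹ * pair H.X H.Y = 1 := inv_mul_cancel₀ hp
    rw [hcol, hcol, sigmaM, Matrix.diagonal_apply]
    split_ifs <;> simp only [Fin.ext_iff, Fin.val_last] at * <;> first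
      | omega
      | (simp only [herm_add_left, herm_add_right, herm_sub_left, herm_sub_right, herm_smul_left,
          herm_smul_right, hXX, hYY, hXY, hYX, hvX, hvY, hXv, hYv, H.v_on, hsp, hs2, mul_zero,
          add_zero, sub_zero, zero_add, sub_self, Fin.ext_iff]
         done)
      | (rw [H.v_on, if_pos (Fin.ext (by simp only; omega))])
      | (rw [H.v_on, if_neg (fun h => by simp only [Fin.ext_iff] at h; omega)])
      | (simp only [herm_add_left, herm_add_right, herm_sub_left, herm_sub_right, herm_smul_left,
          herm_smul_right, hXX, hYY, hXY, hYX, hsp, hs2]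
         field_simp
         ring)
  have hmat : H.Aᴴ * sigmaM n * H.A = sigmaM n := by
    ext l j
    rw [← hgram, herm_eq_dotProduct, Matrix.mul_assoc, Matrix.mul_apply]
    simp [dotProduct, Matrix.mulVec, Matrix.mul_apply]
  rw [herm_eq_dotProduct, herm_eq_dotProduct, Matrix.star_mulVec, ← Matrix.dotProduct_mulVec,
    Matrix.mulVec_mulVec, Matrix.mulVec_mulVec, hmat]

lemma HypElt.T_nonneg (H : HypElt n G) : 0 ≤ H.T :=
  div_nonneg (by linarith [H.lam_sq]) (by positivity)

lemma HypElt.T_lt_one (H : HypElt n G) : H.T < 1 := by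
  rw [HypElt.T, div_lt_one (by positivity)]
  linarith

lemma curve_mem_ball (hn : 0 < n) {x : ℝ} (hx0 : 0 ≤ x) (hx1 : x < 1) : curve n hn x ∈ ball n := by
  change ∑ i, ‖curve n hn x i‖ ^ 2 < 1
  rw [Finset.sum_eq_single (lastI n hn) (fun i _ hi => by simp [curve, hi]) (by simp)]
  simp only [curve, if_true, Complex.norm_real, Real.norm_eq_abs, sq_abs]
  nlinarith

lemma continuous_curve (hn : 0 < n) : Continuous (curve n hn) := by
  refine continuous_pi fun i => ?_
  unfold curve
  split_ifs
  · exact Complex.continuous_ofReal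
  · exact continuous_const

lemma continuousOn_act {A : Matrix (Fin (n + 1)) (Fin (n + 1)) ℂ}
    (hA : ∀ u v, herm (A *ᵥ u) (A *ᵥ v) = herm u v) : ContinuousOn (act A) (ball n) := by
  refine continuousOn_pi.mpr fun i => ContinuousOn.div ?_ ?_ fun z hz => denom_ne_zero hA hz
  · fun_prop
  · unfold denom
    fun_prop

lemma Kr_pos {z : Fin n → ℂ} (hz : z ∈ ball n) : 0 < Kr z := by
  have h : ∑ i, ‖z i‖ ^ 2 < 1 := hz
  have h' : 0 < 1 - ∑ i, ‖z i‖ ^ 2 := by linarith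
  unfold Kr
  positivity

lemma continuousOn_Kr : ContinuousOn (Kr (n := n)) (ball n) := by
  refine continuousOn_const.mul (ContinuousOn.pow (ContinuousOn.inv₀ (by fun_prop) ?_) _)
  intro z hz
  have h : ∑ i, ‖z i‖ ^ 2 < 1 := hz
  linarith

lemma continuousOn_Kr_rpow (s : ℝ) :
    ContinuousOn (fun z : Fin n → ℂ => ((Kr z ^ s : ℝ) : ℂ)) (ball n) :=
  Complex.continuous_ofReal.comp_continuousOn
    (continuousOn_Kr.rpow_const fun _ hz => Or.inl (Kr_pos hz).ne')

end

end BallPaper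

open BallPaper in
/-- Θ_C^{(k)} is holomorphic on 𝔹ⁿ and automorphic of weight k,
i.e. Θ_C^{(k)} ∈ H̃⁰_Γ(k). -/
theorem ThetaC_in_Htilde (n : ℕ) (hn : 0 < n) (G : BallPaper.DiscreteGroup n)
    (H : BallPaper.HypElt n G) (k : ℕ) (hk : 2 ≤ k) :
    Htilde G k (ThetaC hn H k) := by
  have hx : ∀ x ∈ Set.uIcc 0 H.T, curve n hn x ∈ ball n := fun x hx => by
    rw [Set.uIcc_of_le H.T_nonneg] at hx
    exact curve_mem_ball hn hx.1 (hx.2.trans_lt H.T_lt_one)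
  have hwb : ∀ x ∈ Set.uIcc 0 H.T, act H.A (curve n hn x) ∈ ball n := fun x h =>
    act_mem_ball (H.herm_A_mulVec hn) (hx x h)
  have hcurve : ContinuousOn (curve n hn) (Set.uIcc 0 H.T) := (continuous_curve hn).continuousOn
  have hw : ContinuousOn (fun x => act H.A (curve n hn x)) (Set.uIcc 0 H.T) :=
    (continuousOn_act (H.herm_A_mulVec hn)).comp hcurve hx
  refine ⟨?_, fun B hB z hz => ?_⟩
  · have h := differentiableOn_integral_ThetaPt G hk hw hwb
      (((continuousOn_Kr_rpow (-(k : ℝ) / 2)).comp hw hwb).mul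
        ((continuousOn_Kr_rpow (((n : ℝ) + 1))⁻¹).comp hcurve hx))
    refine h.congr fun z _ => ?_
    simp only [ThetaC, Pi.mul_apply, Function.comp_apply, mul_assoc]
  · rw [ThetaC, ThetaC, ← intervalIntegral.integral_mul_const]
    refine intervalIntegral.integral_congr fun x _ => ?_
    simp only [← ThetaPt_act k (act H.A (curve n hn x)) hB hz]
    ring
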